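/- Any Borel subequivalence relation of a μ-amenable countable Borel equivalence relation on a standard probability space (X, μ) is μ-amenable. -/

import Mathlib

open Filter Topology MeasureTheory Set

variable {X : Type*} [MeasurableSpace X]

/-- A countable Borel equivalence relation `R` is Borel amenable on a set `A`:
there is a sequence of measurable families of probability measures `p n x` on the
`R`-classes with `‖p n x − p n y‖₁ → 0` for `R`-equivalent `x, y` in `A`. -/
def BorelAmenableOn (R : X → X → Prop) (A : Set X) : Prop :=
  ∃ p : ℕ → X → X → ℝ,
    (∀ n, Measurable fun q : X × X => p n q.1 q.2) ∧
    (∀ n x y, 0 ≤ p n x y) ∧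
    (∀ n, ∀ x ∈ A, ∀ y, p n x y ≠ 0 → y ∈ A ∧ R x y) ∧
    (∀ n, ∀ x ∈ A, ∑' y : {y : X // R x y}, p n x (y : X) = 1) ∧
    (∀ x ∈ A, ∀ y ∈ A, R x y →
      Tendsto (fun n => ∑' z : X, |p n x z - p n y z|) atTop (nhds 0))

/-- `R` is `μ`-amenable: Borel amenable after restriction to a `μ`-conull Borel set. -/
def MuAmenable (R : X → X → Prop) (μ : Measure X) : Prop :=
  ∃ A : Set X, MeasurableSet A ∧ μ Aᶜ = 0 ∧ BorelAmenableOn R A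

/-- A set covered exactly by countably many measurable sets on which `π` is injective. -/
def IsSigmaInjOn {Z Y : Type*} [MeasurableSpace Z] (π : Z → Y) (D : Set Z) : Prop :=
  ∃ 𝓔 : Set (Set Z), 𝓔.Countable ∧ (∀ E ∈ 𝓔, MeasurableSet E ∧ InjOn π E) ∧ D = ⋃₀ 𝓔

namespace IsSigmaInjOn

variable {Z Y : Type*} [MeasurableSpace Z] {π : Z → Y}

theorem empty : IsSigmaInjOn π ∅ := ⟨∅, by simp⟩

theorem measurableSet {D : Set Z} (h : IsSigmaInjOn π D) : MeasurableSet D := by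
  obtain ⟨𝓔, hc, hE, rfl⟩ := h
  exact .sUnion hc fun E h => (hE E h).1

theorem of_injOn {D : Set Z} (hD : MeasurableSet D) (h : InjOn π D) : IsSigmaInjOn π D :=
  ⟨{D}, by simp [hD, h]⟩

theorem iUnion {ι : Type*} [Countable ι] {D : ι → Set Z} (h : ∀ i, IsSigmaInjOn π (D i)) :
    IsSigmaInjOn π (⋃ i, D i) := by
  choose 𝓔 hc hE hD using h
  refine ⟨⋃ i, 𝓔 i, countable_iUnion hc, fun E hmem => ?_, ?_⟩
  · obtain ⟨i, hi⟩ := mem_iUnion.1 hmem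
    exact hE i E hi
  · rw [sUnion_iUnion]
    exact iUnion_congr hD

theorem union {D D' : Set Z} (h : IsSigmaInjOn π D) (h' : IsSigmaInjOn π D') :
    IsSigmaInjOn π (D ∪ D') := by
  rw [union_eq_iUnion]
  exact iUnion fun b => by cases b <;> assumption

end IsSigmaInjOn

theorem analyticSet_setOf_exists_ne_of_eq {Ω Z Y : Type*} [MeasurableSpace Ω]
    [StandardBorelSpace Ω] [TopologicalSpace Z] [PolishSpace Z] [MeasurableSpace Z] [BorelSpace Z]
    [MeasurableSpace Y] [StandardBorelSpace Y] {π : Z → Y} (hπ : Measurable π) {h : Ω → Z}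
    (hh : Measurable h) {T : Set Ω} (hT : MeasurableSet T) :
    AnalyticSet {z | ∃ t ∈ T, h t ≠ z ∧ π (h t) = π z} := by
  have hm : MeasurableSet {q : Ω × Z | q.1 ∈ T ∧ h q.1 ≠ q.2 ∧ π (h q.1) = π q.2} := by
    refine (measurable_fst hT).inter (.inter ?_ ?_)
    · exact (measurableSet_eq_fun (hh.comp measurable_fst) measurable_snd).compl
    · exact measurableSet_eq_fun (hπ.comp (hh.comp measurable_fst)) (hπ.comp measurable_snd)
  convert hm.analyticSet_image measurable_snd
  ext z
  simp

/-- If a measurable map is injective on the measurable image of a Borel set, then it is injective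
on a Borel superset of that image. -/
theorem exists_measurableSet_superset_injOn {Ω Z Y : Type*} [MeasurableSpace Ω]
    [StandardBorelSpace Ω] [MeasurableSpace Z] [StandardBorelSpace Z] [MeasurableSpace Y]
    [StandardBorelSpace Y] {π : Z → Y} (hπ : Measurable π) {h : Ω → Z} (hh : Measurable h)
    {T : Set Ω} (hT : MeasurableSet T) (hinj : InjOn π (h '' T)) :
    ∃ B, MeasurableSet B ∧ h '' T ⊆ B ∧ InjOn π B := by
  let := upgradeStandardBorel Z
  obtain ⟨B₁, hEB₁, hdisj₁, hB₁⟩ := (hT.analyticSet_image hh).measurablySeparable 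
      (analyticSet_setOf_exists_ne_of_eq hπ hh hT) <| by
    rw [Set.disjoint_left]
    rintro z hz ⟨t, ht, hne, heq⟩
    exact hne (hinj (mem_image_of_mem h ht) hz heq)
  obtain ⟨B₂, hEB₂, hdisj₂, hB₂⟩ := (hT.analyticSet_image hh).measurablySeparable
      (analyticSet_setOf_exists_ne_of_eq hπ measurable_id hB₁) <| by
    rw [Set.disjoint_left]
    rintro _ ⟨t, ht, rfl⟩ ⟨w, hw, hne, heq⟩
    exact Set.disjoint_left.1 hdisj₁ ⟨t, ht, hne.symm, heq.symm⟩ hw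
  refine ⟨B₁ ∩ B₂, hB₁.inter hB₂, subset_inter hEB₁ hEB₂, fun a ha b hb hab => ?_⟩
  by_contra hne
  exact Set.disjoint_left.1 hdisj₂ ⟨a, ha.1, hne, hab⟩ hb.2

/-- The product of the `U i` contains, outside every `IsSigmaInjOn` set, a sequence lying in a single
fibre of `π`. -/
def IsLargeFamily {Z Y : Type*} [MeasurableSpace Z] (π : Z → Y) (U : ℕ → Set Z) : Prop :=
  ∀ D, IsSigmaInjOn π D → ∃ z : ℕ → Z, ∀ i, z i ∈ U i ∧ z i ∉ D ∧ π (z i) = π (z 0)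

theorem exists_disjoint_closed_of_ne {Z : Type*} [MetricSpace Z] {d : ℕ → Z} (hd : DenseRange d)
    {a b : Z} (hab : a ≠ b) {ε : ℝ} (hε : 0 < ε) :
    ∃ k k' l : ℕ, Disjoint (Metric.closedBall (d k) (1 / (l + 1 : ℝ)))
      (Metric.closedBall (d k') (1 / (l + 1 : ℝ))) ∧ 1 / (l + 1 : ℝ) ≤ ε ∧
      a ∈ Metric.closedBall (d k) (1 / (l + 1 : ℝ)) ∧
      b ∈ Metric.closedBall (d k') (1 / (l + 1 : ℝ)) := by
  have hpos : 0 < dist a b := dist_pos.2 hab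
  obtain ⟨l, hl⟩ := exists_nat_one_div_lt (lt_min hε (by positivity : 0 < dist a b / 4))
  have hl0 : (0 : ℝ) < 1 / (l + 1 : ℝ) := by positivity
  obtain ⟨k, hk⟩ := hd.exists_dist_lt a hl0
  obtain ⟨k', hk'⟩ := hd.exists_dist_lt b hl0
  obtain ⟨h1, h2⟩ := lt_min_iff.1 hl
  refine ⟨k, k', l, ?_, h1.le, hk.le, hk'.le⟩
  refine Metric.closedBall_disjoint_closedBall ?_
  have := dist_triangle4 a (d k) (d k') b
  rw [dist_comm (d k') b] at this
  linarith

/-- In a large family, `U j` may be replaced by two disjoint closed pieces of small diameter, the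
second one taking the place of `U m`, so that the family stays large. -/
theorem IsLargeFamily.split {Z Y : Type*} [MetricSpace Z] [CompleteSpace Z]
    [SecondCountableTopology Z] [MeasurableSpace Z] [BorelSpace Z] [MeasurableSpace Y]
    [StandardBorelSpace Y] {π : Z → Y} (hπ : Measurable π) {U : ℕ → Set Z}
    (hU : ∀ i, MeasurableSet (U i)) (hlarge : IsLargeFamily π U) {j m : ℕ} (hm0 : m ≠ 0)
    (hjm : j ≠ m) {ε : ℝ} (hε : 0 < ε) :
    ∃ V W : Set Z, IsClosed V ∧ IsClosed W ∧ Disjoint V W ∧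
      (∀ a ∈ V, ∀ b ∈ V, dist a b ≤ ε) ∧
      IsLargeFamily π (Function.update (Function.update U j (U j ∩ V)) m (U j ∩ W)) := by
  have : Nonempty Z := by
    obtain ⟨z, -⟩ := hlarge ∅ .empty
    exact ⟨z 0⟩
  let d := TopologicalSpace.denseSeq Z
  let C : ℕ → ℕ → Set Z := fun k l => Metric.closedBall (d k) (1 / (l + 1 : ℝ))
  let I := {p : ℕ × ℕ × ℕ // Disjoint (C p.1 p.2.2) (C p.2.1 p.2.2) ∧ 1 / (p.2.2 + 1 : ℝ) ≤ ε / 2}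
  have small : ∀ p : I, ∀ k, ∀ a ∈ C k p.1.2.2, ∀ b ∈ C k p.1.2.2, dist a b ≤ ε := by
    intro p k a ha b hb
    have := dist_triangle_right a b (d k)
    have h1 := Metric.mem_closedBall.1 ha
    have h2 := Metric.mem_closedBall.1 hb
    linarith [p.2.2]
  by_contra! hcon
  have hD : ∀ p : I, ∃ D, IsSigmaInjOn π D ∧ ∀ z : ℕ → Z, ¬ ∀ i,
      z i ∈ Function.update (Function.update U j (U j ∩ C p.1.1 p.1.2.2)) m
        (U j ∩ C p.1.2.1 p.1.2.2) i ∧ z i ∉ D ∧ π (z i) = π (z 0) := by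
    intro p
    have := hcon _ _ Metric.isClosed_closedBall Metric.isClosed_closedBall p.2.1
      (small p _)
    unfold IsLargeFamily at this
    push Not at this
    obtain ⟨D, hD, h⟩ := this
    refine ⟨D, hD, fun z hz => ?_⟩
    obtain ⟨i, hi⟩ := h z
    exact hi (hz i).1 (hz i).2.1 (hz i).2.2
  choose D hDs hDz using hD
  have hDu : IsSigmaInjOn π (⋃ p, D p) := .iUnion hDs
  set T : Set (ℕ → Z) := {z | ∀ i, z i ∈ U i ∧ z i ∉ ⋃ p, D p ∧ π (z i) = π (z 0)} with hTdef
  have hT : MeasurableSet T := by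
    rw [hTdef, ofPred_forall]
    refine .iInter fun i => ?_
    have hi : Measurable fun z : ℕ → Z => z i := measurable_pi_apply i
    exact (hi (hU i)).inter ((hi hDu.measurableSet).compl.inter
      (measurableSet_eq_fun (hπ.comp hi) (hπ.comp (measurable_pi_apply 0))))
  have hinj : InjOn π ((fun z : ℕ → Z => z j) '' T) := by
    rintro _ ⟨z, hz, rfl⟩ _ ⟨z', hz', rfl⟩ heq
    by_contra hne
    obtain ⟨k, k', l, hdisj, hl, ha, hb⟩ :=
      exists_disjoint_closed_of_ne (TopologicalSpace.denseRange_denseSeq Z) hne (half_pos hε)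
    refine hDz ⟨(k, k', l), hdisj, hl⟩ (Function.update z m (z' j)) fun i => ?_
    rw [Function.update_of_ne hm0.symm]
    have hnot : ∀ w, w ∉ ⋃ p, D p → w ∉ D ⟨(k, k', l), hdisj, hl⟩ := fun w hw h =>
      hw (mem_iUnion.2 ⟨_, h⟩)
    rcases eq_or_ne i m with rfl | him
    · simp only [Function.update_self]
      exact ⟨⟨(hz' j).1, hb⟩, hnot _ (hz' j).2.1, heq.symm.trans (hz j).2.2⟩
    · rw [Function.update_of_ne him, Function.update_of_ne him]
      refine ⟨?_, hnot _ (hz i).2.1, (hz i).2.2⟩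
      rcases eq_or_ne i j with rfl | hij
      · rw [Function.update_self]
        exact ⟨(hz i).1, ha⟩
      · rw [Function.update_of_ne hij]
        exact (hz i).1
  obtain ⟨B, hB, hTB, hBinj⟩ :=
    exists_measurableSet_superset_injOn hπ (measurable_pi_apply j) hT hinj
  obtain ⟨z, hz⟩ := hlarge _ (hDu.union (.of_injOn hB hBinj))
  exact (hz j).2.1 <| .inr <|
    hTB ⟨z, fun i => ⟨(hz i).1, fun h => (hz i).2.1 (.inl h), (hz i).2.2⟩, rfl⟩

/-- Iterated splitting of a large family: at stage `n` the member `(Nat.unpair n).1` is shrunk and the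
member `n + 1` is split off from it. -/
theorem IsLargeFamily.exists_scheme {Z Y : Type*} [MetricSpace Z] [CompleteSpace Z]
    [SecondCountableTopology Z] [MeasurableSpace Z] [BorelSpace Z] [MeasurableSpace Y]
    [StandardBorelSpace Y] {π : Z → Y} (hπ : Measurable π)
    (hlarge : IsLargeFamily π fun _ => univ) :
    ∃ U : ℕ → ℕ → Set Z, (∀ n i, IsClosed (U n i)) ∧ (∀ n, IsLargeFamily π (U n)) ∧
      (∀ n, ∀ i ≤ n, U (n + 1) i ⊆ U n i) ∧
      (∀ n, ∀ a ∈ U (n + 1) n.unpair.1, ∀ b ∈ U (n + 1) n.unpair.1,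
        dist a b ≤ 1 / (n + 1 : ℝ)) ∧
      (∀ n, U (n + 1) (n + 1) ⊆ U n n.unpair.1) ∧
      ∀ n, Disjoint (U (n + 1) n.unpair.1) (U (n + 1) (n + 1)) := by
  have hne : ∀ n : ℕ, n.unpair.1 ≠ n + 1 := fun n =>
    (Nat.lt_succ_of_le n.unpair_left_le).ne
  have step : ∀ (n : ℕ) (s : {U : ℕ → Set Z // (∀ i, IsClosed (U i)) ∧ IsLargeFamily π U}),
      ∃ t : {U : ℕ → Set Z // (∀ i, IsClosed (U i)) ∧ IsLargeFamily π U},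
        (∀ i ≤ n, t.1 i ⊆ s.1 i) ∧
        (∀ a ∈ t.1 n.unpair.1, ∀ b ∈ t.1 n.unpair.1, dist a b ≤ 1 / (n + 1 : ℝ)) ∧
        t.1 (n + 1) ⊆ s.1 n.unpair.1 ∧ Disjoint (t.1 n.unpair.1) (t.1 (n + 1)) := by
    rintro n ⟨U, hU, hL⟩
    obtain ⟨V, W, hV, hW, hVW, hVε, hL'⟩ := hL.split hπ (fun i => (hU i).measurableSet)
      n.succ_ne_zero (hne n) (Nat.one_div_pos_of_nat (α := ℝ) (n := n))
    refine ⟨⟨_, fun i => ?_, hL'⟩, fun i hi => ?_, ?_, ?_, ?_⟩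
    · rw [Function.update_apply, Function.update_apply]
      split_ifs
      exacts [(hU _).inter hW, (hU _).inter hV, hU i]
    · dsimp only
      rw [Function.update_of_ne (by lia), Function.update_apply]
      split_ifs with h
      exacts [h ▸ inter_subset_left, Subset.rfl]
    · dsimp only
      rw [Function.update_of_ne (hne n), Function.update_self]
      exact fun a ha b hb => hVε a ha.2 b hb.2
    · dsimp only
      rw [Function.update_self]
      exact inter_subset_left
    · dsimp only
      rw [Function.update_of_ne (hne n), Function.update_self, Function.update_self]
      exact hVW.mono inter_subset_right inter_subset_right
  choose f hf using step
  let s : ℕ → {U : ℕ → Set Z // (∀ i, IsClosed (U i)) ∧ IsLargeFamily π U} :=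
    fun n => Nat.rec ⟨fun _ => univ, fun _ => isClosed_univ, hlarge⟩ f n
  exact ⟨fun n => (s n).1, fun n => (s n).2.1, fun n => (s n).2.2, fun n => (hf n (s n)).1,
    fun n => (hf n (s n)).2.1, fun n => (hf n (s n)).2.2.1, fun n => (hf n (s n)).2.2.2⟩

/-- The limit points of the splitting scheme form a dense-in-itself subset of one fibre. -/
theorem IsLargeFamily.exists_not_countable_fiber {Z Y : Type*} [MetricSpace Z] [CompleteSpace Z]
    [SecondCountableTopology Z] [MeasurableSpace Z] [BorelSpace Z] [TopologicalSpace Y]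
    [PolishSpace Y] [MeasurableSpace Y] [BorelSpace Y] {π : Z → Y} (hπ : Continuous π)
    (hlarge : IsLargeFamily π fun _ => univ) : ∃ y, ¬ (π ⁻¹' {y}).Countable := by
  obtain ⟨U, hclosed, hL, hmono, hdiam, hsub, hdisj⟩ := hlarge.exists_scheme hπ.measurable
  have anti : ∀ {i n n'}, i ≤ n → n ≤ n' → U n' i ⊆ U n i := by
    intro i n n' hi hn
    induction n', hn using Nat.le_induction with
    | base => exact Subset.rfl
    | succ k hk ih => exact (hmono k i (hi.trans hk)).trans ih
  have stage : ∀ i N, ∃ n : ℕ, N ≤ n ∧ n.unpair.1 = i := fun i N =>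
    ⟨Nat.pair i N, Nat.right_le_pair i N, by simp⟩
  have shrink : ∀ i {ε : ℝ}, 0 < ε → ∃ N ≥ i, ∀ a ∈ U N i, ∀ b ∈ U N i, dist a b < ε := by
    intro i ε hε
    obtain ⟨M, hM⟩ := exists_nat_one_div_lt hε
    obtain ⟨n, hn, rfl⟩ := stage i M
    refine ⟨n + 1, n.unpair_left_le.trans n.le_succ, fun a ha b hb => ?_⟩
    exact (hdiam n a ha b hb).trans_lt ((Nat.one_div_le_one_div hn).trans_lt hM)
  choose w hw using fun n => hL n ∅ .empty
  have hcauchy : ∀ i, CauchySeq fun n => w n i := by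
    intro i
    refine Metric.cauchySeq_iff'.2 fun ε hε => ?_
    obtain ⟨N, hN, h⟩ := shrink i hε
    exact ⟨N, fun n hn => h _ (anti hN hn (hw n i).1) _ (hw N i).1⟩
  choose z hz using fun i => cauchySeq_tendsto_of_complete (hcauchy i)
  have hzU : ∀ {i n}, i ≤ n → z i ∈ U n i := fun {i n} hi =>
    (hclosed n i).mem_of_tendsto (hz i) <|
      (eventually_ge_atTop n).mono fun k hk => anti hi hk (hw k i).1
  have hfib : ∀ i, π (z i) = π (z 0) := by
    intro i
    refine tendsto_nhds_unique ((hπ.tendsto _).comp (hz i)) ?_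
    refine ((hπ.tendsto _).comp (hz 0)).congr fun n => ?_
    exact ((hw n i).2.2).symm
  have hpre : Preperfect (range z) := by
    rw [preperfect_iff_nhds]
    rintro _ ⟨i, rfl⟩ O hO
    obtain ⟨ε, hε, hεO⟩ := Metric.mem_nhds_iff.1 hO
    obtain ⟨N, hN, h⟩ := shrink i hε
    obtain ⟨n, hn, rfl⟩ := stage i N
    refine ⟨z (n + 1), ⟨hεO ?_, mem_range_self _⟩, ?_⟩
    · exact h _ (anti hN hn (hsub n (hzU le_rfl))) _ (hzU hN)
    · intro heq
      exact Set.disjoint_left.1 (hdisj n) (hzU (n.unpair_left_le.trans n.le_succ))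
        (heq ▸ hzU le_rfl)
  refine ⟨π (z 0), fun hc => ?_⟩
  obtain ⟨f, hf, -, hinj⟩ :=
    hpre.perfect_closure.exists_nat_bool_injection (range_nonempty z).closure
  have hcl : closure (range z) ⊆ π ⁻¹' {π (z 0)} :=
    closure_minimal (range_subset_iff.2 hfib) (isClosed_singleton.preimage hπ)
  have huncount : Cardinal.aleph0 < Cardinal.mk (ℕ → Bool) := by
    simpa using Cardinal.cantor Cardinal.aleph0
  have hcount := (hc.mono (hf.trans hcl)).preimage hinj
  rw [preimage_range, countable_univ_iff] at hcount
  exact (Cardinal.mk_le_aleph0_iff.2 hcount).not_gt huncount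

/-- **Lusin–Novikov**: a Borel map with countable fibres is injective on each piece of a countable
Borel partition; here in the form of a cover. -/
theorem Measurable.isSigmaInjOn_univ {Z Y : Type*} [MeasurableSpace Z] [StandardBorelSpace Z]
    [MeasurableSpace Y] [StandardBorelSpace Y] {π : Z → Y} (hπ : Measurable π)
    (hc : ∀ y, (π ⁻¹' {y}).Countable) : IsSigmaInjOn π univ := by
  let := upgradeStandardBorel Y
  let tZ := upgradeStandardBorel Z
  have hpolZ : PolishSpace Z := inferInstance
  have hbZ : BorelSpace Z := inferInstance
  obtain ⟨t, hle, hcont, hpol⟩ := hπ.exists_continuous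
  have hb : @BorelSpace Z t _ := by
    refine @BorelSpace.mk Z t _ ?_
    rw [borel_eq_borel_of_le hpol hpolZ hle]
    exact hbZ.measurable_eq
  clear hle hpolZ hbZ
  clear tZ
  let := TopologicalSpace.upgradeIsCompletelyMetrizable Z
  by_contra hnot
  obtain ⟨y, hy⟩ := IsLargeFamily.exists_not_countable_fiber hcont fun D hD => by
    obtain ⟨a, ha⟩ := (ne_univ_iff_exists_notMem D).1 fun h => hnot (h ▸ hD)
    exact ⟨fun _ => a, fun _ => ⟨mem_univ _, ha, rfl⟩⟩
  exact hy (hc y)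

/-- A Borel relation with countable sections is covered by countably many Borel functions. -/
theorem exists_measurable_seq_of_countable_sections {Y Z : Type*} [MeasurableSpace Y]
    [StandardBorelSpace Y] [MeasurableSpace Z] [StandardBorelSpace Z] {R : Y → Z → Prop}
    (hR : MeasurableSet {q : Y × Z | R q.1 q.2}) (hc : ∀ x, {y | R x y}.Countable) [Nonempty Z] :
    ∃ g : ℕ → Y → Z, (∀ n, Measurable (g n)) ∧ ∀ x y, R x y → ∃ n, g n x = y := by
  have := hR.standardBorel
  let π : {q : Y × Z | R q.1 q.2} → Y := fun q => q.1.1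
  have hπ : Measurable π := measurable_fst.comp measurable_subtype_coe
  obtain ⟨𝓔, h𝓔, hE, huniv⟩ := hπ.isSigmaInjOn_univ fun x => by
    refine countable_of_injective_of_countable_image 
      (f := fun q : {q : Y × Z | R q.1 q.2} => q.1.2) ?_ ((hc x).mono ?_)
    · rintro q hq q' hq' h
      exact Subtype.ext (Prod.ext (hq.trans hq'.symm) h)
    · rintro _ ⟨q, rfl, rfl⟩
      exact q.2
  have hext : ∀ E : 𝓔, ∃ g : Y → Z, Measurable g ∧ ∀ q ∈ E.1, g q.1.1 = q.1.2 := by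
    rintro ⟨E, hmem⟩
    have := (hE E hmem).1.standardBorel
    have hemb : MeasurableEmbedding fun q : E => π q.1 :=
      (hπ.comp measurable_subtype_coe).measurableEmbedding
        (injOn_iff_injective.1 (hE E hmem).2)
    obtain ⟨g, hg, hgq⟩ := hemb.exists_measurable_extend (g := fun q : E => q.1.1.2)
      (measurable_snd.comp (measurable_subtype_coe.comp measurable_subtype_coe)) fun _ => ‹_›
    exact ⟨g, hg, fun q hq => congr_fun hgq ⟨q, hq⟩⟩
  choose g hg hgq using hext
  have := h𝓔.to_subtype
  rcases isEmpty_or_nonempty 𝓔 with hempty | hne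
  · refine ⟨fun _ _ => Classical.arbitrary Z, fun _ => measurable_const, fun x y hxy => ?_⟩
    obtain ⟨E, hmem, -⟩ := huniv ▸ mem_univ (⟨(x, y), hxy⟩ : {q : Y × Z | R q.1 q.2})
    exact (hempty.false ⟨E, hmem⟩).elim
  · obtain ⟨e, he⟩ := exists_surjective_nat 𝓔
    refine ⟨fun n => g (e n), fun n => hg _, fun x y hxy => ?_⟩
    obtain ⟨E, hmem, hq⟩ := huniv ▸ mem_univ (⟨(x, y), hxy⟩ : {q : Y × Z | R q.1 q.2})
    obtain ⟨n, hn⟩ := he ⟨E, hmem⟩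
    exact ⟨n, by simpa [hn] using hgq ⟨E, hmem⟩ _ hq⟩

/-- Fibrewise sums along `φ` do not increase the `ℓ¹`-distance. -/
theorem tsum_abs_tsum_fiber_sub_le {Y Z : Type*} {a b : Z → ℝ} (ha : Summable a)
    (hb : Summable b) (φ : Z → Y) :
    ∑' y, |∑' z : φ ⁻¹' {y}, a z - ∑' z : φ ⁻¹' {y}, b z| ≤ ∑' z, |a z - b z| := by
  have hab : Summable fun z => |a z - b z| := (ha.sub hb).abs
  have hfib := hab.hasSum.tsum_fiberwise φ
  have hle : ∀ y, |∑' z : φ ⁻¹' {y}, a z - ∑' z : φ ⁻¹' {y}, b z| ≤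
      ∑' z : φ ⁻¹' {y}, |a z - b z| := by
    intro y
    have hsub : ∑' z : φ ⁻¹' {y}, a z - ∑' z : φ ⁻¹' {y}, b z = ∑' z : φ ⁻¹' {y}, (a z - b z) :=
      ((ha.subtype _).tsum_sub (hb.subtype _)).symm
    rw [hsub]
    have := norm_tsum_le_tsum_norm (f := fun z : φ ⁻¹' {y} => a z - b z) (hab.subtype _)
    simpa only [Real.norm_eq_abs] using this
  rw [← hfib.tsum_eq]
  exact (Summable.of_nonneg_of_le (fun _ => abs_nonneg _) hle hfib.summable).tsum_le_tsum hle
    hfib.summable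

/-- A sum over countable sections enumerated by Borel functions depends measurably on
the parameter. -/
theorem measurable_tsum_of_support_subset_range {Ω Z : Type*} [MeasurableSpace Ω]
    [MeasurableSpace Z] [StandardBorelSpace Z] {g : ℕ → Ω → Z} (hg : ∀ n, Measurable (g n))
    {h : Ω → Z → ENNReal} (hh : Measurable fun q : Ω × Z => h q.1 q.2)
    (hsupp : ∀ ω z, h ω z ≠ 0 → ∃ n, g n ω = z) : Measurable fun ω => ∑' z, h ω z := by
  classical
  have key : ∀ ω, ∑' z, h ω z =
      ∑' k, if ∀ i < k, g i ω ≠ g k ω then h ω (g k ω) else 0 := by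
    intro ω
    have hz : ∀ z, h ω z =
        ∑' k, if z = g k ω then (if ∀ i < k, g i ω ≠ g k ω then h ω (g k ω) else 0) else 0 := by
      intro z
      by_cases hex : ∃ n, g n ω = z
      · rw [tsum_eq_single (Nat.find hex)]
        · rw [if_pos (Nat.find_spec hex).symm, if_pos, Nat.find_spec hex]
          intro i hi heq
          exact Nat.find_min hex hi (heq.trans (Nat.find_spec hex))
        · intro k hk
          split_ifs with h1 h2
          · rcases hk.lt_or_gt with hlt | hlt
            · exact (Nat.find_min hex hlt h1.symm).elim
            · exact (h2 _ hlt ((Nat.find_spec hex).trans h1)).elim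
          · rfl
          · rfl
      · have : ∀ k, z ≠ g k ω := fun k hk => hex ⟨k, hk.symm⟩
        simp only [this, if_false, tsum_zero]
        by_contra h0
        exact hex (hsupp ω z h0)
    rw [tsum_congr hz, ENNReal.tsum_comm]
    exact tsum_congr fun k => tsum_ite_eq _ _
  simp_rw [key]
  refine Measurable.tsum fun k => Measurable.ite ?_ ?_ measurable_const
  · simp only [ofPred_forall]
    exact .iInter fun i => .iInter fun _ => (measurableSet_eq_fun (hg i) (hg k)).compl
  · exact hh.comp (measurable_id.prodMk (hg k))

/-- For a Borel set `B` of pairs `(x, y)` and Borel functions `g n`, the value `g n z` at the least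
`n` such that `(x, g n z) ∈ B` is a Borel function of `(x, z)`. -/
theorem measurable_first_hit {Y Z W : Type*} [MeasurableSpace Y] [MeasurableSpace Z]
    [MeasurableSpace W] {g : ℕ → Z → W} (hg : ∀ n, Measurable (g n)) {B : Set (Y × W)}
    (hB : MeasurableSet B) :
    Measurable fun q : Y × Z => g (sInf {n | (q.1, g n q.2) ∈ B}) q.2 := by
  have hP : ∀ n, MeasurableSet {q : Y × Z | (q.1, g n q.2) ∈ B} := fun n =>
    (measurable_fst.prodMk ((hg n).comp measurable_snd)) hB
  have hN : Measurable fun q : Y × Z => sInf {n | (q.1, g n q.2) ∈ B} := by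
    refine measurable_to_countable' fun k => ?_
    have heq : (fun q : Y × Z => sInf {n | (q.1, g n q.2) ∈ B}) ⁻¹' {k} =
        {q | (q.1, g k q.2) ∈ B} ∩ (⋂ m, ⋂ _ : m < k, {q | (q.1, g m q.2) ∈ B}ᶜ) ∪
          {_q | k = 0} ∩ ⋂ m, {q | (q.1, g m q.2) ∈ B}ᶜ := by
      ext q
      simp only [mem_preimage, mem_singleton_iff, mem_union, mem_inter_iff, mem_iInter,
        mem_compl_iff, mem_ofPred_eq]
      constructor
      · rintro rfl
        by_cases hne : {n | (q.1, g n q.2) ∈ B}.Nonempty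
        · exact .inl ⟨Nat.sInf_mem hne, fun m hm => Nat.notMem_of_lt_sInf hm⟩
        · have hemp := not_nonempty_iff_eq_empty.1 hne
          exact .inr ⟨by rw [hemp, Nat.sInf_empty], fun m hm => hne ⟨m, hm⟩⟩
      · rintro (⟨hk, hlt⟩ | ⟨rfl, hall⟩)
        · exact le_antisymm (Nat.sInf_le hk) (not_lt.1 fun h => hlt _ h
            (Nat.sInf_mem (s := {n | (q.1, g n q.2) ∈ B}) ⟨k, hk⟩))
        · have hemp : {n | (q.1, g n q.2) ∈ B} = ∅ := eq_empty_of_forall_notMem hall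
          rw [hemp, Nat.sInf_empty]
    rw [heq]
    exact ((hP k).inter (.iInter fun m => .iInter fun _ => (hP m).compl)).union
      ((MeasurableSet.const _).inter (.iInter fun m => (hP m).compl))
  exact (measurable_from_prod_countable_right (f := fun r : ℕ × Z => g r.1 r.2) hg).comp
    (hN.prodMk measurable_snd)

/-- Borel amenability passes to Borel subequivalence relations: for `x ∈ A`, push `p n x` forward
along the map sending `z` to the first point of its enumerated `R`-class that lies in `A` and is
`S`-equivalent to `x`. -/
theorem BorelAmenableOn.of_subrel {X : Type*} [MeasurableSpace X] [StandardBorelSpace X]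
    {R S : X → X → Prop} (hR : Equivalence R) (hS : Equivalence S)
    (hRcnt : ∀ x, {y | R x y}.Countable)
    (hRmeas : MeasurableSet {q : X × X | R q.1 q.2})
    (hSmeas : MeasurableSet {q : X × X | S q.1 q.2})
    (hsub : ∀ x y, S x y → R x y) {A : Set X} (hA : MeasurableSet A)
    (hamen : BorelAmenableOn R A) : BorelAmenableOn S A := by
  classical
  obtain ⟨p, hpm, hp0, hpsupp, hpsum, hplim⟩ := hamen
  rcases isEmpty_or_nonempty X with hX | hX
  · exact ⟨p, hpm, hp0, fun _ x => hX.elim x, fun _ x => hX.elim x, fun x => hX.elim x⟩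
  obtain ⟨g, hg, hgR⟩ := exists_measurable_seq_of_countable_sections hRmeas hRcnt
  let F : X → X → X := fun x z => g (sInf {n | (x, g n z) ∈ {q : X × X | q.2 ∈ A ∧ S q.1 q.2}}) z
  have hF : Measurable fun q : X × X => F q.1 q.2 :=
    measurable_first_hit hg ((measurable_snd hA).inter hSmeas)
  have hFmem : ∀ x ∈ A, ∀ z, R x z → F x z ∈ A ∧ S x (F x z) := by
    intro x hx z hxz
    obtain ⟨n, hn⟩ := hgR z x (hR.symm hxz)
    exact Nat.sInf_mem (s := {n | (x, g n z) ∈ {q : X × X | q.2 ∈ A ∧ S q.1 q.2}})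
      ⟨n, by simpa [hn] using ⟨hx, hS.refl x⟩⟩
  have hFinv : ∀ x y, S x y → F x = F y := by
    intro x y hxy
    have : ∀ w, S x w ↔ S y w := fun w => ⟨hS.trans (hS.symm hxy), hS.trans hxy⟩
    funext z
    simp only [F, mem_ofPred_eq, this]
  have hpsum' : ∀ n, ∀ x ∈ A, HasSum (p n x) 1 := by
    intro n x hx
    have hs : Summable fun y : {y // R x y} => p n x y := by
      by_contra h
      exact zero_ne_one ((tsum_eq_zero_of_not_summable h).symm.trans (hpsum n x hx))
    have := hs.hasSum
    rw [hpsum n x hx] at this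
    exact (hasSum_subtype_iff_of_support_subset (s := {y | R x y})
      fun y hy => (hpsupp n x hx y hy).2).1 this
  let q : ℕ → X → X → ℝ := fun n x y => if x ∈ A then ∑' z : F x ⁻¹' {y}, p n x z else 0
  have hqsupp : ∀ n, ∀ x ∈ A, ∀ y, q n x y ≠ 0 → y ∈ A ∧ S x y := by
    intro n x hx y hy
    simp only [q, if_pos hx] at hy
    obtain ⟨⟨z, rfl⟩, hz⟩ : ∃ z : F x ⁻¹' {y}, p n x z ≠ 0 := by
      by_contra! h
      exact hy (by simp [h])
    exact hFmem x hx z (hpsupp n x hx z hz).2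
  refine ⟨q, fun n => ?_, fun n x y => ?_, hqsupp, fun n x hx => ?_, fun x hx y hy hxy => ?_⟩
  · let h : X × X → X → ENNReal := fun r z =>
      if r.1 ∈ A ∧ F r.1 z = r.2 then ENNReal.ofReal (p n r.1 z) else 0
    have hh : Measurable fun r : (X × X) × X => h r.1 r.2 := by
      have h1 : Measurable fun r : (X × X) × X => (r.1.1, r.2) := by fun_prop
      refine Measurable.ite ?_ ((hpm n).comp h1).ennreal_ofReal measurable_const
      exact (measurable_fst.comp measurable_fst hA).inter
        (measurableSet_eq_fun (hF.comp h1) (measurable_snd.comp measurable_fst))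
    have hm := measurable_tsum_of_support_subset_range
      (g := fun k (r : X × X) => g k r.1) (fun k => (hg k).comp measurable_fst) hh ?_
    · convert hm.ennreal_toReal with r
      by_cases hr : r.1 ∈ A
      · have hs := (hpsum' n r.1 hr).summable
        simp only [q, h, hr, if_true, true_and]
        rw [tsum_subtype (F r.1 ⁻¹' {r.2}) (p n r.1), ENNReal.tsum_toReal_eq]
        · refine tsum_congr fun z => ?_
          by_cases hz : F r.1 z = r.2 <;> simp [hz, hp0]
        · intro z
          split_ifs <;> simp
      · simp [q, h, hr]
    · intro r z hz
      simp only [h, ne_eq, ite_eq_right_iff, Classical.not_imp, ENNReal.ofReal_eq_zero, not_le] at hz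
      exact hgR _ _ (hpsupp n r.1 hz.1.1 z hz.2.ne').2
  · simp only [q]
    split_ifs
    exacts [tsum_nonneg fun z => hp0 _ _ _, le_rfl]
  · have hsum : HasSum (q n x) 1 := by
      simpa only [q, if_pos hx] using (hpsum' n x hx).tsum_fiberwise (F x)
    rw [← hsum.tsum_eq]
    exact tsum_subtype_eq_of_support_subset (s := {y | S x y})
      fun y hy => (hqsupp n x hx y hy).2
  · refine squeeze_zero (fun n => tsum_nonneg fun z => abs_nonneg _) (fun n => ?_)
      (hplim x hx y hy (hsub x y hxy))
    simp only [q, if_pos hx, if_pos hy]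
    rw [hFinv x y hxy]
    exact tsum_abs_tsum_fiber_sub_le (hpsum' n x hx).summable (hpsum' n y hy).summable _

/-- Any Borel subequivalence relation of a `μ`-amenable countable
Borel equivalence relation on a standard probability space is `μ`-amenable. -/
theorem muAmenable_of_subrel [StandardBorelSpace X]
    (μ : Measure X) [IsProbabilityMeasure μ]
    (R S : X → X → Prop) (hR : Equivalence R) (hS : Equivalence S)
    (hRcnt : ∀ x, {y | R x y}.Countable)
    (hRmeas : MeasurableSet {q : X × X | R q.1 q.2})
    (hSmeas : MeasurableSet {q : X × X | S q.1 q.2})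
    (hsub : ∀ x y, S x y → R x y)
    (hamen : MuAmenable R μ) :
    MuAmenable S μ := by
  obtain ⟨A, hA, hμ, h⟩ := hamen
  exact ⟨A, hA, hμ, h.of_subrel hR hS hRcnt hRmeas hSmeas hsub hA⟩
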